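/- Let Σ = {σ₁,…,σₙ} be a finite family of injective non-unital ring endomorphisms of a ring R. Then R is Σ-semicommutative and reduced if and only if R is Σ-rigid. -/

import Mathlib

/-- A non-unital ring endomorphism: an additive and multiplicative map
(not required to send `1` to `1`). -/
def IsNUEnd {R : Type*} [Ring R] (σ : R → R) : Prop :=
  (∀ a b : R, σ (a + b) = σ a + σ b) ∧ (∀ a b : R, σ (a * b) = σ a * σ b)

/-- For a family `σ : Fin n → R → R` and `α ∈ ℕⁿ`, the composition
`σ₁^{α₁} ∘ ⋯ ∘ σₙ^{αₙ}`. -/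
def famPow {R : Type*} {n : ℕ} (σ : Fin n → R → R) (α : Fin n → ℕ) : R → R :=
  (List.ofFn (fun i => (σ i)^[α i])).foldr (· ∘ ·) id

/-- `R` is `Σ`-semicommutative: `a * b = 0` implies `a * r * σ^α(b) = 0`
for every `r ∈ R` and every `α ≠ 0`. -/
def SigmaSemicomm {R : Type*} [Ring R] {n : ℕ} (σ : Fin n → R → R) : Prop :=
  ∀ a b : R, a * b = 0 → ∀ r : R, ∀ α : Fin n → ℕ, α ≠ 0 → a * r * famPow σ α b = 0

/-- `R` is `σ`-semicommutative (single endomorphism). -/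
def SingleSemicomm {R : Type*} [Ring R] (σ : R → R) : Prop :=
  ∀ a b : R, a * b = 0 → ∀ r : R, a * r * σ b = 0

/-- `R` is `Σ`-rigid: `a * σ^α(a) = 0` implies `a = 0`. -/
def SigmaRigid {R : Type*} [Ring R] {n : ℕ} (σ : Fin n → R → R) : Prop :=
  ∀ (a : R) (α : Fin n → ℕ), a * famPow σ α a = 0 → a = 0

/-- `δ` is a `σ`-derivation of `R`. -/
def IsSigmaDerivation {R : Type*} [Ring R] (σ δ : R → R) : Prop :=
  (∀ a b : R, δ (a + b) = δ a + δ b) ∧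
    (∀ a b : R, δ (a * b) = σ a * δ b + δ a * b)

/-- The left annihilator `l_R(S)` of a subset `S ⊆ R`. -/
def leftAnn {R : Type*} [Ring R] (S : Set R) : Set R :=
  {x : R | ∀ s ∈ S, x * s = 0}

/-- The right annihilator `r_R(S)` of a subset `S ⊆ R`. -/
def rightAnn {R : Type*} [Ring R] (S : Set R) : Set R :=
  {x : R | ∀ s ∈ S, s * x = 0}

/-- `R` is Baer (left annihilator version): the left annihilator of every
nonempty subset is of the form `Re` for an idempotent `e`. -/
def IsBaerLeft (R : Type*) [Ring R] : Prop :=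
  ∀ S : Set R, S.Nonempty →
    ∃ e : R, e * e = e ∧ leftAnn S = {x : R | ∃ r : R, x = r * e}

/-- `R` is Baer (right annihilator version): the right annihilator of every
nonempty subset is of the form `eR` for an idempotent `e`. -/
def IsBaerRight (R : Type*) [Ring R] : Prop :=
  ∀ S : Set R, S.Nonempty →
    ∃ e : R, e * e = e ∧ rightAnn S = {x : R | ∃ r : R, x = e * r}

/-- `R` is quasi-Baer: the right annihilator of every right ideal
(an additive subgroup closed under right multiplication) is of the form `eR`
for an idempotent `e`. -/
def IsQuasiBaer (R : Type*) [Ring R] : Prop :=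
  ∀ I : AddSubgroup R, (∀ a ∈ I, ∀ r : R, a * r ∈ I) →
    ∃ e : R, e * e = e ∧ rightAnn (I : Set R) = {x : R | ∃ r : R, x = e * r}

theorem IsNUEnd.comp {R : Type*} [Ring R] {σ τ : R → R} (hσ : IsNUEnd σ) (hτ : IsNUEnd τ) :
    IsNUEnd (σ ∘ τ) :=
  ⟨fun a b => by simp [hτ.1, hσ.1], fun a b => by simp [hτ.2, hσ.2]⟩

theorem IsNUEnd.id {R : Type*} [Ring R] : IsNUEnd (id : R → R) :=
  ⟨fun _ _ => rfl, fun _ _ => rfl⟩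

theorem IsNUEnd.iterate {R : Type*} [Ring R] {σ : R → R} (hσ : IsNUEnd σ) (k : ℕ) :
    IsNUEnd σ^[k] := by
  induction k with
  | zero => exact .id
  | succ k ih => exact ih.comp hσ

theorem IsNUEnd.map_zero {R : Type*} [Ring R] {σ : R → R} (hσ : IsNUEnd σ) : σ 0 = 0 := by
  simpa using hσ.1 0 0

/-- A property of self-maps that holds for `id`, is stable under composition and holds for every
factor `(σ i)^[α i]` holds for their composition `famPow σ α`. -/
theorem famPow_induction {R : Type*} {n : ℕ} {P : (R → R) → Prop} (hid : P id)
    (hcomp : ∀ {f g}, P f → P g → P (f ∘ g)) {σ : Fin n → R → R} {α : Fin n → ℕ}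
    (hσ : ∀ i, P (σ i)^[α i]) : P (famPow σ α) := by
  have hfold (l : List (R → R)) (hl : ∀ f ∈ l, P f) : P (l.foldr (· ∘ ·) id) := by
    induction l with
    | nil => exact hid
    | cons f l ih => exact hcomp (f := f) (hl f (by simp)) (ih fun g hg => hl g (by simp [hg]))
  refine hfold _ fun f hf => ?_
  obtain ⟨i, rfl⟩ := List.mem_ofFn.1 hf
  exact hσ i

theorem famPow_zero {R : Type*} {n : ℕ} (σ : Fin n → R → R) : famPow σ 0 = id :=
  famPow_induction (P := (· = id)) rfl (by rintro _ _ rfl rfl; rfl) fun _ => rfl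

theorem IsReduced.eq_zero_of_mul_self {R : Type*} [Ring R] [IsReduced R] {a : R}
    (h : a * a = 0) : a = 0 :=
  IsReduced.eq_zero a ⟨2, by rw [pow_two, h]⟩

theorem IsReduced.mul_eq_zero_symm {R : Type*} [Ring R] [IsReduced R] {a b : R}
    (h : a * b = 0) : b * a = 0 :=
  eq_zero_of_mul_self (by rw [mul_assoc, ← mul_assoc a, h, zero_mul, mul_zero])

/-- `R` is `Σ`-semicommutative and reduced iff `R` is
`Σ`-rigid. -/
theorem sigma_semicomm_reduced_iff_rigid {R : Type*} [Ring R] {n : ℕ}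
    (σ : Fin n → R → R) (hσ : ∀ i, IsNUEnd (σ i))
    (hinj : ∀ i, Function.Injective (σ i)) :
    (SigmaSemicomm σ ∧ IsReduced R) ↔ SigmaRigid σ := by
  have hend (α : Fin n → ℕ) : IsNUEnd (famPow σ α) :=
    famPow_induction .id .comp fun i => (hσ i).iterate _
  have hinj' (α : Fin n → ℕ) : Function.Injective (famPow σ α) :=
    famPow_induction Function.injective_id .comp fun i => (hinj i).iterate _
  constructor
  · rintro ⟨hsemi, hred⟩ a α ha
    by_cases hα : α = 0
    · subst hα
      rw [famPow_zero] at ha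
      exact IsReduced.eq_zero_of_mul_self ha
    · have h := hsemi _ _ (IsReduced.mul_eq_zero_symm ha) 1 α hα
      rw [mul_one] at h
      exact hinj' α ((IsReduced.eq_zero_of_mul_self h).trans (hend α).map_zero.symm)
  · intro hrig
    have hred : IsReduced R := (isReduced_iff_pow_one_lt 2 one_lt_two).2 fun a ha =>
      hrig a 0 (by rw [famPow_zero, id, ← pow_two, ha])
    refine ⟨fun a b hab r α _ => hrig _ α ?_, hred⟩
    have hba : famPow σ α b * famPow σ α a = 0 := by
      rw [← (hend α).2, IsReduced.mul_eq_zero_symm hab, (hend α).map_zero]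
    rw [mul_assoc a r, (hend α).2 a, ← mul_assoc a r, mul_assoc (a * r),
      ← mul_assoc (famPow σ α b), hba, zero_mul, mul_zero]
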